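/- Let ℓ₁, ℓ₂, N be positive integers with ℓ₁ + ℓ₂ ≥ N and ℓ₂ ≤ N. Set D = min(ℓ₁,N) + ℓ₂ - N and let n = D + m + 1 with 0 ≤ m ≤ N - ℓ₂ - 1 and n ≤ min(ℓ₁,N). Then 𝒬ₙ(x; ℓ₁, ℓ₂, N) = ((-N+ℓ₂+1)_m / (-min(ℓ₁,N))_n) · ∏_{j=N-ℓ₂}^{min(ℓ₁,N)} (x - j) · 𝒬ₘ(x; N-ℓ₂-1, |N-ℓ₁|-1, max(ℓ₁,N)) as polynomials in x. In particular, 𝒬ₙ(x; ℓ₁, ℓ₂, N) vanishes for every integer x with N - min(ℓ₂,N) ≤ x ≤ min(ℓ₁,N). -/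

import Mathlib

/-- Pochhammer symbol `(a)_n = a(a+1)⋯(a+n-1)`. -/
def poch {R : Type*} [CommRing R] (a : R) (n : ℕ) : R :=
  ∏ i ∈ Finset.range n, (a + i)

/-- Hahn polynomial with negative integer parameters `a = -l1-1`, `b = -l2-1`. -/
def hahnQ (l1 l2 Nq : ℚ) (n : ℕ) (x : ℚ) : ℚ :=
  ∑ k ∈ Finset.range (n + 1),
    poch (-(n : ℚ)) k * poch ((n : ℚ) - l1 - l2 - 1) k * poch (-x) k /
      (poch (-l1) k * poch (-Nq) k * (k.factorial : ℚ))

theorem poch_zero {R : Type*} [CommRing R] (a : R) : poch a 0 = 1 := by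
  simp [poch]

theorem poch_succ {R : Type*} [CommRing R] (a : R) (n : ℕ) :
    poch a (n + 1) = poch a n * (a + n) := by
  simp [poch, Finset.prod_range_succ]

theorem poch_add {R : Type*} [CommRing R] (a : R) (m n : ℕ) :
    poch a (m + n) = poch a m * poch (a + m) n := by
  simp [poch, Finset.prod_range_add, add_assoc]

theorem poch_succ' {R : Type*} [CommRing R] (a : R) (n : ℕ) :
    poch a (n + 1) = a * poch (a + 1) n := by
  rw [add_comm n 1, poch_add]
  simp [poch]

/-- The falling factorial `x(x-1)⋯(x-n+1)`. -/
def fallingFactorial {R : Type*} [CommRing R] (x : R) (n : ℕ) : R :=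
  (-1) ^ n * poch (-x) n

theorem fallingFactorial_add {R : Type*} [CommRing R] (x : R) (m n : ℕ) :
    fallingFactorial x (m + n) = fallingFactorial x m * fallingFactorial (x - m) n := by
  unfold fallingFactorial
  rw [poch_add, pow_add, show -(x - (m : R)) = -x + m by ring]
  ring

theorem fallingFactorial_succ' {R : Type*} [CommRing R] (x : R) (n : ℕ) :
    fallingFactorial x (n + 1) = x * fallingFactorial (x - 1) n := by
  rw [add_comm n 1, fallingFactorial_add]
  simp [fallingFactorial, poch]

theorem fallingFactorial_natCast {R : Type*} [CommRing R] (m n : ℕ) :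
    fallingFactorial (m : R) n = m.choose n * n.factorial := by
  rw [← Nat.cast_mul, mul_comm, ← Nat.descFactorial_eq_factorial_mul_choose]
  induction n with
  | zero => simp [fallingFactorial, poch]
  | succ n ih =>
    rw [fallingFactorial_add, ih, Nat.descFactorial_succ]
    rcases le_or_gt n m with h | h
    · push_cast [h]
      simp [fallingFactorial, poch]
      ring
    · simp [Nat.descFactorial_eq_zero_iff_lt.mpr h]

theorem poch_neg_natCast_ne_zero {P k : ℕ} (h : k ≤ P) : poch (-(P : ℚ)) k ≠ 0 := by
  refine Finset.prod_ne_zero_iff.mpr fun i hi => ?_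
  have : (i : ℚ) < P := by exact_mod_cast (Finset.mem_range.mp hi).trans_le h
  linarith

/-- The Chu-Vandermonde identity. -/
theorem sum_choose_mul_fallingFactorial_mul_poch {R : Type*} [CommRing R] (e q : R) (k : ℕ) :
    ∑ j ∈ Finset.range (k + 1),
      (k.choose j : R) * (fallingFactorial q j * poch (e + j) (k - j)) = poch (e + q) k := by
  induction k generalizing e q with
  | zero => simp [fallingFactorial, poch]
  | succ k ih =>
    rw [Finset.sum_choose_succ_mul (fun i j => fallingFactorial q i * poch (e + i) j)]
    have first : ∑ j ∈ Finset.range (k + 1),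
        (k.choose j : R) * (fallingFactorial q j * poch (e + j) (k + 1 - j)) =
          (e + k) * poch (e + q) k := by
      rw [← ih, Finset.mul_sum]
      refine Finset.sum_congr rfl fun j hj => ?_
      have hjk : j ≤ k := Nat.lt_succ_iff.mp (Finset.mem_range.mp hj)
      rw [Nat.succ_sub hjk, poch_succ, Nat.cast_sub hjk]
      ring
    have second : ∑ j ∈ Finset.range (k + 1),
        (k.choose j : R) * (fallingFactorial q (j + 1) * poch (e + (j + 1 : ℕ)) (k - j)) =
          q * poch (e + q) k := by
      rw [show e + q = (e + 1) + (q - 1) by ring, ← ih, Finset.mul_sum]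
      refine Finset.sum_congr rfl fun j _ => ?_
      rw [fallingFactorial_succ', show e + ((j + 1 : ℕ) : R) = e + 1 + j by push_cast; ring]
      ring
    rw [first, second, poch_succ]
    ring

theorem poch_neg_mul_poch_neg_div_factorial (p k : ℕ) (x : ℚ) :
    poch (-(p : ℚ)) k * poch (-x) k / k.factorial = p.choose k * fallingFactorial x k := by
  have hp : poch (-(p : ℚ)) k = (-1) ^ k * (p.choose k * k.factorial) := by
    rw [← fallingFactorial_natCast, fallingFactorial, ← mul_assoc, ← mul_pow]
    simp
  have hk : (k.factorial : ℚ) ≠ 0 := by exact_mod_cast k.factorial_ne_zero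
  rw [hp, fallingFactorial]
  field_simp

theorem poch_add_div_poch (e q : ℚ) (k : ℕ) (he : poch e k ≠ 0) :
    poch (e + q) k / poch e k =
      ∑ j ∈ Finset.range (k + 1), (k.choose j : ℚ) * (fallingFactorial q j / poch e j) := by
  rw [← sum_choose_mul_fallingFactorial_mul_poch, Finset.sum_div]
  refine Finset.sum_congr rfl fun j hj => ?_
  have hjk : j ≤ k := Nat.lt_succ_iff.mp (Finset.mem_range.mp hj)
  have hs : poch e k = poch e j * poch (e + j) (k - j) := by
    rw [← poch_add, Nat.add_sub_cancel' hjk]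
  rw [hs] at he ⊢
  have h1 := left_ne_zero_of_mul he
  have h2 := right_ne_zero_of_mul he
  field_simp

/-- A symmetric single-sum form of the terminating series `₃F₂(-p, q - X, -x; -P, -X; 1)`. -/
theorem sum_poch_eq_sum_choose (p q P X : ℕ) (x : ℚ) (hP : p ≤ P) (hX : p ≤ X) :
    ∑ k ∈ Finset.range (p + 1),
      poch (-(p : ℚ)) k * poch (-(X : ℚ) + q) k * poch (-x) k /
        (poch (-(P : ℚ)) k * poch (-(X : ℚ)) k * (k.factorial : ℚ)) =
    (∑ j ∈ Finset.range (p + 1), (p.choose j : ℚ) * (q.choose j * j.factorial) *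
      (fallingFactorial x j / poch (-(X : ℚ)) j) * poch (x - P) (p - j)) / poch (-(P : ℚ)) p := by
  have hexp : ∀ k ∈ Finset.range (p + 1),
      poch (-(p : ℚ)) k * poch (-(X : ℚ) + q) k * poch (-x) k /
        (poch (-(P : ℚ)) k * poch (-(X : ℚ)) k * (k.factorial : ℚ)) =
      ∑ j ∈ Finset.range (k + 1), (p.choose k : ℚ) * fallingFactorial x k / poch (-(P : ℚ)) k *
        ((k.choose j : ℚ) * (fallingFactorial (q : ℚ) j / poch (-(X : ℚ)) j)) := by
    intro k hk
    have hkp : k ≤ p := Nat.lt_succ_iff.mp (Finset.mem_range.mp hk)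
    rw [← Finset.mul_sum, ← poch_add_div_poch _ _ _ (poch_neg_natCast_ne_zero (hkp.trans hX)),
      ← poch_neg_mul_poch_neg_div_factorial]
    simp only [div_eq_mul_inv, mul_inv]
    ring
  rw [Finset.sum_congr rfl hexp, Finset.sum_comm' (t' := Finset.range (p + 1))
    (s' := fun j => Finset.Ico j (p + 1)) (by intro a b; simp; omega), Finset.sum_div]
  refine Finset.sum_congr rfl fun j hj => ?_
  have hjp : j ≤ p := Nat.lt_succ_iff.mp (Finset.mem_range.mp hj)
  rw [Finset.sum_Ico_eq_sum_range, show x - (P : ℚ) = (-P + j) + (x - j) by ring,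
    ← sum_choose_mul_fallingFactorial_mul_poch, Nat.succ_sub hjp, Finset.mul_sum, Finset.sum_div]
  refine Finset.sum_congr rfl fun i hi => ?_
  have hip : i ≤ p - j := Nat.lt_succ_iff.mp (Finset.mem_range.mp hi)
  have hs : poch (-(P : ℚ)) p =
      poch (-(P : ℚ)) (j + i) * poch (-(P : ℚ) + j + i) (p - j - i) := by
    rw [show -(P : ℚ) + j + i = -P + (j + i : ℕ) by push_cast; ring, ← poch_add]
    congr 1
    omega
  have hc : (p.choose (j + i) : ℚ) * (j + i).choose j = p.choose j * (p - j).choose i := by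
    have := Nat.choose_mul (n := p) (k := j + i) (s := j) (by omega)
    rw [Nat.add_sub_cancel_left] at this
    exact_mod_cast this
  have hne := poch_neg_natCast_ne_zero hP
  rw [fallingFactorial_natCast, fallingFactorial_add, hs]
  rw [hs] at hne
  have h1 := left_ne_zero_of_mul hne
  have h2 := right_ne_zero_of_mul hne
  have h3 := poch_neg_natCast_ne_zero (hjp.trans hX)
  field_simp
  linear_combination (fallingFactorial x j * fallingFactorial (x - j) i * q.choose j) *
    hc

/-- The factorization, for the series with `n - m = M - c`. -/
theorem sum_poch_factorization (m d c X : ℕ) (x : ℚ) (hmc : m ≤ c) (hX : m + d ≤ X) :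
    ∑ k ∈ Finset.range (m + d + 1),
      poch (-((m + d : ℕ) : ℚ)) k * poch (-(X : ℚ) + m) k * poch (-x) k /
        (poch (-((c + d : ℕ) : ℚ)) k * poch (-(X : ℚ)) k * (k.factorial : ℚ)) =
    poch (-(c : ℚ)) m / poch (-((c + d : ℕ) : ℚ)) (m + d) * poch (x - (c + d : ℕ)) d *
      ∑ k ∈ Finset.range (m + 1),
        poch (-(m : ℚ)) k * poch (-(X : ℚ) + (m + d : ℕ)) k * poch (-x) k /
          (poch (-(c : ℚ)) k * poch (-(X : ℚ)) k * (k.factorial : ℚ)) := by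
  rw [sum_poch_eq_sum_choose (m + d) m (c + d) X x (by omega) hX,
    sum_poch_eq_sum_choose m (m + d) c X x hmc (by omega)]
  have hc := poch_neg_natCast_ne_zero hmc
  rw [← Finset.sum_subset (Finset.range_mono (show m + 1 ≤ m + d + 1 by omega))
    (fun j _ hj => by
      rw [Nat.choose_eq_zero_of_lt (show m < j by simpa using hj)]
      simp)]
  rw [show ∀ a b y s : ℚ, a / b * y * (s / a) = (a / a) * (y * s) / b by intros; ring,
    div_self hc, one_mul, Finset.mul_sum]
  congr 1
  refine Finset.sum_congr rfl fun j hj => ?_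
  have hjm : j ≤ m := Nat.lt_succ_iff.mp (Finset.mem_range.mp hj)
  rw [show m + d - j = d + (m - j) by omega, poch_add,
    show x - ((c + d : ℕ) : ℚ) + d = x - c by push_cast; ring]
  ring

theorem prod_Icc_sub_eq_poch (c d : ℕ) (x : ℚ) :
    ∏ j ∈ Finset.Icc (c + 1) (c + d), (x - (j : ℚ)) = poch (x - (c + d : ℕ)) d := by
  induction d with
  | zero => simp [poch]
  | succ d ih =>
    rw [← add_assoc, Finset.prod_Icc_succ_top (by omega), ih, poch_succ', mul_comm]
    congr 2
    push_cast
    ring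

theorem hahnQ_eq_prod_mul_hahnQ (N l1 l2 : ℕ) (h : N ≤ l1 + l2) (m n : ℕ)
    (hmN : m + l2 + 1 ≤ N) (hn : n = (min l1 N + l2 - N) + m + 1) (hn' : n ≤ min l1 N) (x : ℚ) :
    hahnQ l1 l2 N n x =
      poch (-(N : ℚ) + l2 + 1) m / poch (-(min l1 N : ℚ)) n *
        (∏ j ∈ Finset.Icc (N - l2) (min l1 N), (x - (j : ℚ))) *
        hahnQ ((N : ℚ) - l2 - 1) (|(N : ℚ) - l1| - 1) (max l1 N : ℕ) m x := by
  obtain ⟨c, rfl⟩ : ∃ c, N = c + l2 + 1 := ⟨N - l2 - 1, by omega⟩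
  obtain ⟨d, hd⟩ : ∃ d, min l1 (c + l2 + 1) = c + d := ⟨min l1 (c + l2 + 1) - c, by omega⟩
  obtain rfl : n = m + d := by omega
  have hmin : min (l1 : ℚ) ((c + l2 + 1 : ℕ) : ℚ) = ((c + d : ℕ) : ℚ) := by
    rw [← hd, Nat.cast_min]
  rw [hmin, hd, show c + l2 + 1 - l2 = c + 1 by omega, prod_Icc_sub_eq_poch,
    show -((c + l2 + 1 : ℕ) : ℚ) + l2 + 1 = -c by push_cast; ring]
  have key := sum_poch_factorization m d c (max l1 (c + l2 + 1)) x (by omega) (by omega)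
  unfold hahnQ
  rw [show ((c + l2 + 1 : ℕ) : ℚ) - l2 - 1 = c by push_cast; ring]
  rcases le_total l1 (c + l2 + 1) with hl | hl
  · rw [min_eq_left hl] at hd
    rw [max_eq_right hl] at key ⊢
    have hl' : (l1 : ℚ) ≤ (c + l2 + 1 : ℕ) := by exact_mod_cast hl
    rw [abs_of_nonneg (by linarith)]
    subst hd
    convert key using 6
    · push_cast
      ring
    · congr 2
      push_cast
      ring
  · rw [min_eq_right hl] at hd
    rw [max_eq_left hl] at key ⊢
    have hl' : ((c + l2 + 1 : ℕ) : ℚ) ≤ l1 := by exact_mod_cast hl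
    rw [abs_of_nonpos (by linarith)]
    obtain rfl : d = l2 + 1 := by omega
    simp only [mul_comm (poch (-(l1 : ℚ)) _) (poch (-((c + l2 + 1 : ℕ) : ℚ)) _)]
    convert key using 6
    · push_cast
      ring
    · rfl
    · congr 2
      push_cast
      ring

theorem hahn_factorization (N l1 l2 : ℕ) (hN : 0 < N) (h1 : 0 < l1) (h2 : 0 < l2)
    (h : N ≤ l1 + l2) (hl2 : l2 ≤ N) (m n : ℕ)
    (hmN : m + l2 + 1 ≤ N)
    (hn : n = (min l1 N + l2 - N) + m + 1) (hn' : n ≤ min l1 N) :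
    (∀ x : ℚ,
      hahnQ l1 l2 N n x =
        poch (-(N : ℚ) + l2 + 1) m / poch (-(min l1 N : ℚ)) n *
          (∏ j ∈ Finset.Icc (N - l2) (min l1 N), (x - (j : ℚ))) *
          hahnQ ((N : ℚ) - l2 - 1) (|(N : ℚ) - l1| - 1) (max l1 N : ℕ) m x) ∧
    (∀ x : ℕ, N - min l2 N ≤ x → x ≤ min l1 N → hahnQ l1 l2 N n x = 0) := by
  refine ⟨hahnQ_eq_prod_mul_hahnQ N l1 l2 h m n hmN hn hn', fun x hx hx' => ?_⟩
  rw [min_eq_left hl2] at hx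
  rw [hahnQ_eq_prod_mul_hahnQ N l1 l2 h m n hmN hn hn',
    Finset.prod_eq_zero (Finset.mem_Icc.mpr ⟨hx, hx'⟩) (sub_self _)]
  simp
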